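/- Let S³ denote the one-point compactification OnePoint ℝ³ of ℝ³ (homeomorphic to the 3-sphere), and let S ⊆ S³ be a nonempty compact connected set that is locally Euclidean of dimension 2, i.e. every point of S has an open neighbourhood in S homeomorphic to ℝ² = EuclideanSpace ℝ (Fin 2). Then the topological frontier in S³ of every connected component of S³ ∖ S equals S. -/

import Mathlib

open Set

noncomputable section

/-- Euclidean 3-space. -/
abbrev R3 := EuclideanSpace ℝ (Fin 3)

/-- The 3-sphere, as the one-point compactification of `ℝ³`. -/
abbrev S3 := OnePoint R3

/-- A subset `S` of a topological space is locally Euclidean of dimension 2 if every point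
of `S` has an open neighbourhood in the subspace `S` homeomorphic to `ℝ²`. -/
def LocallyEuclidean2 {X : Type*} [TopologicalSpace X] (S : Set X) : Prop :=
  ∀ p : S, ∃ V : Set S, IsOpen V ∧ p ∈ V ∧ Nonempty (↥V ≃ₜ EuclideanSpace ℝ (Fin 2))

open Metric MeasureTheory Topology

section NoRetraction

variable {E : Type*} [NormedAddCommGroup E] [NormedSpace ℝ E] [FiniteDimensional ℝ E]

/-- `det (1 + A)` is a fixed linear combination of the values `det (1 + t A)` at finitely many
small positive parameters `t`, uniformly in the endomorphism `A`. -/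
theorem exists_det_one_add_eq_sum {ε : ℝ} (hε : 0 < ε) :
    ∃ (s : Finset ℝ) (w : ℝ → ℝ), (∀ t ∈ s, 0 < t ∧ t ≤ ε) ∧
      ∀ A : E →L[ℝ] E, (1 + A).det = ∑ t ∈ s, w t * (1 + t • A).det := by
  set n := Module.finrank ℝ E
  obtain ⟨s, hs, hcard⟩ := (Set.Ioc_infinite hε).exists_subset_card_eq (n + 1)
  refine ⟨s, fun t => (Lagrange.basis s id t).eval 1, fun t ht => hs ht, fun A => ?_⟩
  let b := Module.finBasis ℝ E
  let M := LinearMap.toMatrix b b (A : E →ₗ[ℝ] E)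
  let P : Polynomial ℝ := Matrix.det
    ((Polynomial.X : Polynomial ℝ) • M.map Polynomial.C + (1 : Matrix _ _ ℝ).map Polynomial.C)
  have hP : ∀ t : ℝ, P.eval t = (1 + t • A).det := by
    intro t
    rw [ContinuousLinearMap.det, ← LinearMap.det_toMatrix b]
    rw [← Polynomial.coe_evalRingHom, RingHom.map_det]
    congr 1
    have hM : LinearMap.toMatrix b b ((1 + t • A : E →L[ℝ] E) : E →ₗ[ℝ] E) = 1 + t • M := by
      rw [ContinuousLinearMap.toLinearMap_add, ContinuousLinearMap.toLinearMap_smul, map_add,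
        map_smul]
      simp [M]
    rw [hM]
    ext i j
    by_cases hij : i = j <;> simp [hij, add_comm, mul_comm t]
  have hdeg : P.degree < s.card := by
    rw [hcard]
    refine lt_of_le_of_lt Polynomial.degree_le_natDegree ?_
    have := Polynomial.natDegree_det_X_add_C_le M 1
    simp only [Fintype.card_fin] at this
    exact_mod_cast Nat.lt_succ_of_le this
  have h1 := hP 1
  rw [one_smul] at h1
  rw [← h1, Lagrange.eq_interpolate (f := P) (injOn_id _) hdeg, Lagrange.interpolate_apply,
    Polynomial.eval_finsetSum]
  refine Finset.sum_congr rfl fun t _ => ?_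
  simp [hP, mul_comm]

omit [FiniteDimensional ℝ E] in
theorem lipschitzWith_indicator_closedBall {F : Type*} [NormedAddCommGroup F] {k : E → F}
    {R : ℝ} {C : NNReal}
    (hk : LipschitzOnWith C k (closedBall 0 R)) (hk0 : ∀ x, ‖x‖ = R → k x = 0) :
    LipschitzWith C ((closedBall (0 : E) R).indicator k) := by
  have key : ∀ x ∈ closedBall (0 : E) R, ∀ y ∉ closedBall (0 : E) R,
      dist ((closedBall (0 : E) R).indicator k x) ((closedBall (0 : E) R).indicator k y)
        ≤ C * dist x y := by
    intro x hx y hy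
    rw [indicator_of_mem hx, indicator_of_notMem hy]
    simp only [mem_closedBall, dist_zero_right, not_le] at hx hy
    obtain ⟨s, hs, hsR⟩ : R ∈ (fun s : ℝ => ‖AffineMap.lineMap x y s‖) '' Icc (0 : ℝ) 1 := by
      apply intermediate_value_Icc zero_le_one
      · exact (AffineMap.lineMap_continuous (p := x) (q := y)).norm.continuousOn
      · simpa using ⟨hx, hy.le⟩
    simp only at hsR
    set z : E := AffineMap.lineMap x y s
    have h1 := hk.dist_le_mul x (by simpa using hx) z (by simpa using hsR.le)
    rw [hk0 z hsR] at h1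
    refine h1.trans (mul_le_mul_of_nonneg_left ?_ C.2)
    rw [dist_left_lineMap, Real.norm_of_nonneg hs.1]
    exact mul_le_of_le_one_left dist_nonneg hs.2
  refine LipschitzWith.of_dist_le_mul fun x y => ?_
  by_cases hx : x ∈ closedBall (0 : E) R <;> by_cases hy : y ∈ closedBall (0 : E) R
  · rw [indicator_of_mem hx, indicator_of_mem hy]
    exact hk.dist_le_mul x hx y hy
  · exact key x hx y hy
  · rw [dist_comm, dist_comm x]
    exact key y hy x hx
  · rw [indicator_of_notMem hx, indicator_of_notMem hy]
    simp; positivity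

theorem ContinuousLinearMap.det_one_add_pos_of_norm_lt_one {A : E →L[ℝ] E} (hA : ‖A‖ < 1) :
    0 < (1 + A).det := by
  have hne : ∀ s ∈ Icc (0 : ℝ) 1, (1 + s • A).det ≠ 0 := by
    intro s hs
    have hlt : ‖-(s • A)‖ < 1 := by
      rw [norm_neg, norm_smul, Real.norm_of_nonneg hs.1]
      exact (mul_le_of_le_one_left (norm_nonneg _) hs.2).trans_lt hA
    have hu : IsUnit (1 + s • A) := by
      have := (Units.oneSub _ hlt).isUnit
      simpa using this
    have hu' : IsUnit ((1 + s • A : E →L[ℝ] E) : E →ₗ[ℝ] E) :=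
      hu.map (ContinuousLinearMap.toLinearMapRingHom (R₁ := ℝ) (M₁ := E))
    exact ((LinearMap.isUnit_iff_isUnit_det _).1 hu').ne_zero
  by_contra hcon
  obtain ⟨s, hs, hs0⟩ : (0 : ℝ) ∈ (fun s : ℝ => (1 + s • A).det) '' Icc (0 : ℝ) 1 := by
    apply intermediate_value_Icc' zero_le_one
    · exact (ContinuousLinearMap.continuous_det.comp (by fun_prop)).continuousOn
    · simp only [one_smul, zero_smul, add_zero]
      refine ⟨not_lt.1 hcon, ?_⟩
      simp [ContinuousLinearMap.det]
  exact hne s hs hs0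

variable [MeasurableSpace E] [BorelSpace E] (μ : Measure E) [μ.IsAddHaarMeasure]

/-- For small `t`, the map `id + t k` permutes the ball, so it preserves its volume. -/
theorem exists_setIntegral_det_one_add_smul_fderiv {k : E → E} {R : ℝ}
    (hk : ContDiff ℝ 1 k) (hk0 : ∀ x, ‖x‖ = R → k x = 0) :
    ∃ ε > 0, ∀ t : ℝ, 0 < t → t ≤ ε →
      ∫ x in ball (0 : E) R, (1 + t • fderiv ℝ k x).det ∂μ = μ.real (ball 0 R) := by
  obtain ⟨C, hC⟩ : ∃ C, ∀ x ∈ closedBall (0 : E) R, ‖fderiv ℝ k x‖ ≤ C :=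
    (isCompact_closedBall (0 : E) R).exists_bound_of_continuousOn
      (hk.continuous_fderiv one_ne_zero).continuousOn
  set L : NNReal := max C.toNNReal 1
  have hL1 : 1 ≤ L := le_max_right _ _
  have hLb : ∀ x ∈ closedBall (0 : E) R, ‖fderiv ℝ k x‖ ≤ L := fun x hx =>
    (hC x hx).trans ((Real.le_coe_toNNReal C).trans (by exact_mod_cast le_max_left _ _))
  have hLip : LipschitzOnWith L k (closedBall 0 R) :=
    (convex_closedBall (0 : E) R).lipschitzOnWith_of_nnnorm_fderiv_le
      (fun x _ => (hk.differentiable one_ne_zero) x) hLb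
  set κ := (closedBall (0 : E) R).indicator k
  have hκ : LipschitzWith L κ := lipschitzWith_indicator_closedBall hLip hk0
  have hL0 : (0 : ℝ) < L := lt_of_lt_of_le one_pos (by exact_mod_cast hL1)
  refine ⟨1 / (2 * L), by positivity, fun t ht htε => ?_⟩
  have htL : t * L ≤ 1 / 2 := by
    calc t * L ≤ 1 / (2 * L) * L := by gcongr
      _ = 1 / 2 := by field_simp
  set g : E → E := fun x => x + t • κ x
  have happ : ApproximatesLinearOn g ((ContinuousLinearEquiv.refl ℝ E : E ≃L[ℝ] E) : E →L[ℝ] E)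
      univ (t.toNNReal * L) := by
    rw [ApproximatesLinearOn.approximatesLinearOn_iff_lipschitzOnWith, lipschitzOnWith_univ]
    have : g - ⇑((ContinuousLinearEquiv.refl ℝ E : E ≃L[ℝ] E) : E →L[ℝ] E) = fun x => t • κ x := by
      ext x; simp [g]
    rw [this]
    refine LipschitzWith.of_dist_le_mul fun x y => ?_
    rw [dist_smul₀, Real.norm_of_nonneg ht.le, NNReal.coe_mul, Real.coe_toNNReal _ ht.le, mul_assoc]
    exact mul_le_mul_of_nonneg_left (hκ.dist_le_mul x y) ht.le
  have hc : Subsingleton E ∨ t.toNNReal * L <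
      ‖((ContinuousLinearEquiv.refl ℝ E : E ≃L[ℝ] E).symm : E →L[ℝ] E)‖₊⁻¹ := by
    rcases subsingleton_or_nontrivial E with h | h
    · exact Or.inl h
    · right
      have : ‖((ContinuousLinearEquiv.refl ℝ E : E ≃L[ℝ] E).symm : E →L[ℝ] E)‖₊ = 1 := by
        ext; exact ContinuousLinearMap.norm_id
      rw [this, inv_one, ← NNReal.coe_lt_coe, NNReal.coe_mul, Real.coe_toNNReal _ ht.le]
      norm_num; linarith
  have hinj : Function.Injective g := by
    have := happ.injOn hc
    rwa [injOn_univ] at this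
  have hsurj : Function.Surjective g := happ.surjective hc
  have hout : ∀ x ∉ ball (0 : E) R, g x = x := by
    intro x hx
    have : κ x = 0 := by
      by_cases h : x ∈ closedBall (0 : E) R
      · rw [show κ x = k x from indicator_of_mem h k]
        apply hk0
        simp only [mem_closedBall, dist_zero_right, mem_ball, not_lt] at h hx
        exact le_antisymm h hx
      · exact indicator_of_notMem h k
    simp [g, this]
  have himage : g '' ball 0 R = ball 0 R := by
    have h1 : g '' (ball 0 R)ᶜ = (ball 0 R)ᶜ := by
      exact (image_congr fun x hx => hout x hx).trans (image_id _)
    have h2 := Set.image_compl_eq (s := (ball (0 : E) R)ᶜ) ⟨hinj, hsurj⟩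
    rw [compl_compl, h1, compl_compl] at h2
    exact h2
  have hder : ∀ x ∈ ball (0 : E) R,
      HasFDerivWithinAt g (1 + t • fderiv ℝ k x) (ball 0 R) x := by
    intro x hx
    have : HasFDerivAt (fun x => x + t • k x) (1 + t • fderiv ℝ k x) x :=
      (hasFDerivAt_id x).add (((hk.differentiable one_ne_zero) x).hasFDerivAt.const_smul t)
    refine this.hasFDerivWithinAt.congr (fun y hy => ?_) ?_
    · simp [g, κ, indicator_of_mem (ball_subset_closedBall hy)]
    · simp [g, κ, indicator_of_mem (ball_subset_closedBall hx)]
  have hcv := integral_image_eq_integral_abs_det_fderiv_smul μ measurableSet_ball hder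
    hinj.injOn (fun _ => (1 : ℝ))
  rw [himage] at hcv
  simp only [integral_const, MeasurableSet.univ, measureReal_restrict_apply, univ_inter,
    smul_eq_mul, mul_one] at hcv
  rw [hcv]
  refine setIntegral_congr_fun measurableSet_ball fun x hx => ?_
  refine (abs_of_pos (ContinuousLinearMap.det_one_add_pos_of_norm_lt_one ?_)).symm
  rw [norm_smul, Real.norm_of_nonneg ht.le]
  have := hLb x (ball_subset_closedBall hx)
  nlinarith

theorem setIntegral_det_one_add_fderiv {k : E → E} {R : ℝ}
    (hk : ContDiff ℝ 1 k) (hk0 : ∀ x, ‖x‖ = R → k x = 0) :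
    ∫ x in ball (0 : E) R, (1 + fderiv ℝ k x).det ∂μ = μ.real (ball 0 R) := by
  obtain ⟨ε, hε, h⟩ := exists_setIntegral_det_one_add_smul_fderiv μ hk hk0
  obtain ⟨s, w, hs, hw⟩ := exists_det_one_add_eq_sum (E := E) hε
  have hsum : ∑ t ∈ s, w t = 1 := by
    have := hw 0
    simpa [ContinuousLinearMap.det] using this.symm
  rw [integral_congr_ae (ae_of_all _ fun x => hw (fderiv ℝ k x)), integral_finsetSum]
  · simp_rw [integral_const_mul]
    rw [Finset.sum_congr rfl fun t ht => by rw [h t (hs t ht).1 (hs t ht).2], ← Finset.sum_mul,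
      hsum, one_mul]
  · intro t _
    refine Integrable.const_mul ?_ _
    refine IntegrableOn.mono_set ?_ ball_subset_closedBall
    refine ContinuousOn.integrableOn_compact (isCompact_closedBall _ _) ?_
    have := hk.continuous_fderiv one_ne_zero
    exact (ContinuousLinearMap.continuous_det.comp (by fun_prop)).continuousOn

end NoRetraction

/-- A continuous self-map of a Euclidean space that is the identity near infinity has a zero. -/
theorem exists_eq_zero_of_eq_self_of_le_norm {E : Type*} [NormedAddCommGroup E]
    [InnerProductSpace ℝ E] [FiniteDimensional ℝ E] [Nontrivial E]
    {h : E → E} (hc : Continuous h) {R : ℝ} (hR : ∀ x, R ≤ ‖x‖ → h x = x) : ∃ x, h x = 0 := by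
  by_contra! hne
  wlog hsmooth : ContDiff ℝ 1 h generalizing h R
  · obtain ⟨g, hg, hgd, hgS, -⟩ := hc.exists_contDiff_approx_and_eqOn 1
      (ε := fun x => ‖h x‖) hc.norm (fun x => norm_pos_iff.2 (hne x))
      (S := {x | |R| + 1 ≤ ‖x‖}) (U := {x | |R| < ‖x‖})
      (isClosed_le continuous_const continuous_norm)
      ((isOpen_lt continuous_const continuous_norm).mem_nhdsSet.2 fun x hx =>
        (lt_add_one |R|).trans_le hx)
      (contDiffOn_id.congr fun x (hx : _ < _) => hR x ((le_abs_self R).trans hx.le))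
    refine this hg.continuous (R := |R| + 1)
      (fun x hx => (hgS hx).trans (hR x (by linarith [le_abs_self R]))) (fun x hx => ?_) hg
    have := hgd x
    simp [hx] at this
  borelize E
  set ρ : ℝ := |R| + 1
  have hρ : 0 < ρ := by positivity
  set r : E → E := fun x => (ρ * ‖h x‖⁻¹) • h x
  have hr : ContDiff ℝ 1 r := by
    refine ContDiff.smul (contDiff_const.mul (ContDiff.inv (hsmooth.norm ℝ hne) ?_)) hsmooth
    exact fun x => norm_ne_zero_iff.2 (hne x)
  have hnorm : ∀ x, ‖r x‖ = ρ := by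
    intro x
    have := norm_ne_zero_iff.2 (hne x)
    rw [norm_smul, norm_mul, norm_inv, norm_norm, Real.norm_of_nonneg hρ.le]
    field_simp
  have hk : ContDiff ℝ 1 (fun x => r x - x) := hr.sub contDiff_id
  have hvol := setIntegral_det_one_add_fderiv (volume : Measure E) (R := ρ) hk (by
    intro x hx
    have : h x = x := hR x (by rw [hx]; linarith [le_abs_self R])
    simp [r, this, hx, hρ.ne'])
  have hdet : ∀ x, (1 + fderiv ℝ (fun x => r x - x) x).det = 0 := by
    intro x
    have hrd := (hr.differentiable one_ne_zero) x
    have h1 : 1 + fderiv ℝ (fun x => r x - x) x = fderiv ℝ r x := by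
      have : HasFDerivAt (fun x => r x - x) (fderiv ℝ r x - 1) x :=
        hrd.hasFDerivAt.sub (hasFDerivAt_id x)
      rw [this.fderiv]; abel
    rw [h1]
    have horth : ∀ v, inner ℝ (r x) (fderiv ℝ r x v) = 0 := by
      intro v
      have h2 := hrd.hasFDerivAt.norm_sq
      have h3 : HasFDerivAt (fun x => ‖r x‖ ^ 2) (0 : E →L[ℝ] ℝ) x := by
        simp_rw [hnorm]; exact hasFDerivAt_const _ _
      have h4 := DFunLike.congr_fun (h2.unique h3) v
      simpa using h4
    by_contra hd
    have hu : IsUnit (LinearMap.det (fderiv ℝ r x : E →ₗ[ℝ] E)) := isUnit_iff_ne_zero.2 hd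
    have hs : Function.Surjective (fderiv ℝ r x : E →ₗ[ℝ] E) :=
      (((Module.End.isUnit_iff _).1 ((LinearMap.isUnit_iff_isUnit_det _).2 hu))).2
    obtain ⟨v, hv⟩ := hs (r x)
    have h5 := horth v
    rw [show fderiv ℝ r x v = r x from hv, inner_self_eq_zero] at h5
    have := hnorm x
    simp [h5] at this
    exact hρ.ne this
  simp_rw [hdet] at hvol
  rw [integral_zero] at hvol
  exact (ENNReal.toReal_pos (isOpen_ball.measure_pos _ ⟨0, by simpa using hρ⟩).ne'
    measure_ball_lt_top.ne).ne hvol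

open unitInterval

section Extension

variable {Y E V : Type*} [MetricSpace Y] [NormedAddCommGroup E] [NormedSpace ℝ E]
  [FiniteDimensional ℝ E] [NormedAddCommGroup V] [NormedSpace ℝ V] [FiniteDimensional ℝ V]

/-- The restriction of `f` to `K` extends to a continuous nowhere vanishing function. -/
def ExtendsNonvanishing {Y E : Type*} [TopologicalSpace Y] [TopologicalSpace E] [Zero E]
    (K : Set Y) (f : Y → E) : Prop :=
  ∃ G : Y → E, Continuous G ∧ (∀ y, G y ≠ 0) ∧ EqOn G f K

omit [NormedSpace ℝ E] [FiniteDimensional ℝ E] in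
theorem ExtendsNonvanishing.congr {K : Set Y} {f g : Y → E} (h : ExtendsNonvanishing K f)
    (hfg : EqOn f g K) : ExtendsNonvanishing K g :=
  let ⟨G, hG, hne, hEq⟩ := h
  ⟨G, hG, hne, hEq.trans hfg⟩

/-- Borsuk's homotopy extension property for maps into the complement of the origin. -/
theorem ExtendsNonvanishing.of_homotopy {K : Set Y} (hK : IsClosed K) {H : Y × I → E}
    (hH : ContinuousOn H (K ×ˢ univ)) (hne : ∀ y ∈ K, ∀ t, H (y, t) ≠ 0)
    (h0 : ExtendsNonvanishing K fun y => H (y, 0)) : ExtendsNonvanishing K fun y => H (y, 1) := by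
  classical
  obtain ⟨G, hG, hGne, hGeq⟩ := h0
  set F : Y × I → E := fun p => if p.1 ∈ K then H p else G p.1
  have hFH : EqOn F H (K ×ˢ univ) := fun p hp => if_pos hp.1
  have hF0 : EqOn F (fun p => G p.1) (univ ×ˢ {0}) := by
    rintro ⟨y, t⟩ ⟨-, rfl : t = 0⟩
    by_cases hy : y ∈ K
    · simpa [F, hy] using (hGeq hy).symm
    · simp [F, hy]
  have hc1 : IsClosed (K ×ˢ (univ : Set I)) := hK.prod isClosed_univ
  have hc2 : IsClosed ((univ : Set Y) ×ˢ ({0} : Set I)) := isClosed_univ.prod isClosed_singleton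
  have hFc : ContinuousOn F (K ×ˢ univ ∪ univ ×ˢ {0}) :=
    (hH.congr hFH).union_of_isClosed
      ((hG.comp continuous_fst).continuousOn.congr hF0) hc1 hc2
  have : TietzeExtension E := TietzeExtension.of_tvs ℝ
  obtain ⟨Φ, hΦ⟩ := ContinuousMap.exists_restrict_eq (hc1.union hc2)
    ⟨_, continuousOn_iff_continuous_domRestrict.1 hFc⟩
  have hΦF : ∀ p ∈ K ×ˢ (univ : Set I) ∪ univ ×ˢ {0}, Φ p = F p := fun p hp =>
    DFunLike.congr_fun hΦ ⟨p, hp⟩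
  have hΦH : ∀ y ∈ K, ∀ t, Φ (y, t) = H (y, t) := fun y hy t =>
    (hΦF _ (Or.inl ⟨hy, trivial⟩)).trans (hFH ⟨hy, trivial⟩)
  set B : Set Y := Prod.fst '' {p : Y × I | Φ p = 0}
  have hB : IsClosed B :=
    isClosedMap_fst_of_compactSpace _ (isClosed_eq Φ.continuous continuous_const)
  have hBK : Disjoint B K := by
    rw [Set.disjoint_left]
    rintro _ ⟨⟨y, t⟩, hp, rfl⟩ hy
    exact hne y hy t ((hΦH y hy t).symm.trans hp)
  obtain ⟨φ, hφ0, hφ1, hφI⟩ := exists_continuous_zero_one_of_isClosed hB hK hBK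
  refine ⟨fun y => Φ (y, ⟨φ y, hφI y⟩), by fun_prop, fun y hy => ?_, fun y hy => ?_⟩
  · have hφy : φ y = 0 := hφ0 ⟨_, hy, rfl⟩
    have h1 : Φ (y, 0) = G y :=
      (hΦF (y, 0) (Or.inr ⟨trivial, rfl⟩)).trans (hF0 ⟨trivial, rfl⟩)
    have h2 : (⟨φ y, hφI y⟩ : I) = 0 := Subtype.ext hφy
    simp only [h2] at hy
    exact hGne y (h1.symm.trans hy)
  · have h2 : (⟨φ y, hφI y⟩ : I) = 1 := Subtype.ext (hφ1 hy)
    simp only [h2]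
    exact hΦH y hy 1

theorem ExtendsNonvanishing.of_segment {K : Set Y} (hK : IsClosed K) {f g : Y → E}
    (hf : ContinuousOn f K) (hg : ContinuousOn g K)
    (hne : ∀ y ∈ K, ∀ t : I, (1 - t : ℝ) • f y + (t : ℝ) • g y ≠ 0)
    (h : ExtendsNonvanishing K f) : ExtendsNonvanishing K g := by
  have hfst : MapsTo Prod.fst (K ×ˢ (univ : Set I)) K := fun p hp => hp.1
  have key := ExtendsNonvanishing.of_homotopy hK
    (H := fun p : Y × I => (1 - p.2 : ℝ) • f p.1 + (p.2 : ℝ) • g p.1)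
    (((by fun_prop : Continuous fun p : Y × I => (1 - p.2 : ℝ)).continuousOn.smul
        (hf.comp continuousOn_fst hfst)).add
      ((by fun_prop : Continuous fun p : Y × I => (p.2 : ℝ)).continuousOn.smul
        (hg.comp continuousOn_fst hfst))) hne
  simpa using key (by simpa using h)

/-- Nowhere vanishing maps extend from compact subsets of spaces of smaller dimension. -/
theorem extendsNonvanishing_of_finrank_lt
    (hVE : Module.finrank ℝ V < Module.finrank ℝ E) {K : Set V} (hK : IsCompact K) {f : V → E}
    (hf : ContinuousOn f K) (hne : ∀ y ∈ K, f y ≠ 0) : ExtendsNonvanishing K f := by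
  obtain ⟨δ, hδ, hfδ⟩ := hK.exists_forall_le' hf.norm fun y hy => norm_pos_iff.2 (hne y hy)
  have : TietzeExtension E := TietzeExtension.of_tvs ℝ
  obtain ⟨Φ, hΦ⟩ := ContinuousMap.exists_restrict_eq hK.isClosed
    ⟨_, continuousOn_iff_continuous_domRestrict.1 hf⟩
  have hΦf : ∀ y ∈ K, Φ y = f y := fun y hy => DFunLike.congr_fun hΦ ⟨y, hy⟩
  obtain ⟨g, hg, hgΦ, -⟩ := Φ.continuous.exists_contDiff_approx 1 (ε := fun _ => δ / 2)
    continuous_const (fun _ => by positivity)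
  obtain ⟨c, hc, hcδ⟩ := (hg.dense_compl_range_of_finrank_lt_finrank hVE).exists_dist_lt 0
    (half_pos hδ)
  rw [dist_zero_left] at hcδ
  have hext : ExtendsNonvanishing K fun y => g y - c :=
    ⟨_, hg.continuous.sub continuous_const, fun y hy => hc ⟨y, sub_eq_zero.1 hy⟩, fun _ _ => rfl⟩
  refine hext.of_segment hK.isClosed (hg.continuous.sub continuous_const).continuousOn hf
    fun y hy t h0 => ?_
  have h1 : f y = (1 - t : ℝ) • (f y - g y + c) := by
    rw [← sub_eq_zero, ← h0, Pi.sub_apply]; module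
  have h2 : ‖f y - g y + c‖ < δ := by
    have := hgΦ y
    rw [hΦf y hy, dist_comm, dist_eq_norm] at this
    linarith [norm_add_le (f y - g y) c]
  have h3 : ‖f y‖ ≤ ‖f y - g y + c‖ := by
    calc ‖f y‖ = (1 - t : ℝ) * ‖f y - g y + c‖ := by
          conv_lhs => rw [h1, norm_smul, Real.norm_of_nonneg (by linarith [t.2.2])]
      _ ≤ _ := mul_le_of_le_one_left (norm_nonneg _) (by linarith [t.2.1])
  linarith [hfδ y hy]

theorem ExtendsNonvanishing.sub_of_norm_le {K : Set E} (hK : IsClosed K) {b : E}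
    (h : ∀ y ∈ K, ‖y‖ < ‖b‖) (hb : b ≠ 0) : ExtendsNonvanishing K (· - b) := by
  refine ExtendsNonvanishing.of_segment (f := fun _ => -b) hK continuousOn_const
    (by fun_prop) (fun y hy t h0 => ?_)
    ⟨_, continuous_const, fun _ => neg_ne_zero.2 hb, fun _ _ => rfl⟩
  have h1 : b = (t : ℝ) • y := by rw [← sub_eq_zero, ← neg_eq_zero, ← h0]; module
  have h2 : ‖b‖ ≤ ‖y‖ := by
    rw [h1, norm_smul, Real.norm_of_nonneg t.2.1]
    exact mul_le_of_le_one_left (norm_nonneg _) t.2.2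
  exact (h y hy).not_ge h2

theorem ExtendsNonvanishing.sub_of_mem_ball {K : Set E} (hK : IsClosed K) {a b c : E} {ρ : ℝ}
    (hd : Disjoint (ball c ρ) K) (ha : a ∈ ball c ρ) (hb : b ∈ ball c ρ)
    (h : ExtendsNonvanishing K (· - a)) : ExtendsNonvanishing K (· - b) := by
  refine h.of_segment hK (by fun_prop) (by fun_prop) fun y hy t h0 => ?_
  have h1 : y = (1 - t : ℝ) • a + (t : ℝ) • b := by rw [← sub_eq_zero, ← h0]; module
  refine Set.disjoint_left.1 hd ?_ hy
  rw [h1]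
  exact convex_ball c ρ ha hb (by linarith [t.2.2]) t.2.1 (by ring)

/-- The radial homotopy from the identity to the projection onto the sphere of radius `R`. -/
def radialPush (R : ℝ) (p : V × I) : V := ((1 - p.2 : ℝ) + p.2 * (R * ‖p.1‖⁻¹)) • p.1

omit [FiniteDimensional ℝ V] in
theorem continuousOn_radialPush (R : ℝ) :
    ContinuousOn (radialPush R : V × I → V) {p | p.1 ≠ 0} := by
  unfold radialPush
  refine ContinuousOn.smul (ContinuousOn.add (by fun_prop) (ContinuousOn.mul (by fun_prop)
    (continuousOn_const.mul ?_))) continuousOn_fst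
  exact continuousOn_fst.norm.inv₀ fun p hp => norm_ne_zero_iff.2 hp

omit [FiniteDimensional ℝ V] in
theorem radialPush_zero (R : ℝ) (z : V) : radialPush R (z, 0) = z := by simp [radialPush]

omit [FiniteDimensional ℝ V] in
theorem radialPush_one_mem {R : ℝ} (hR : 0 ≤ R) {z : V} (hz : z ≠ 0) :
    radialPush R (z, 1) ∈ sphere (0 : V) R := by
  have := norm_ne_zero_iff.2 hz
  simp [radialPush, norm_smul, abs_of_nonneg hR, this]

omit [FiniteDimensional ℝ V] in
theorem radialPush_of_mem_sphere {R : ℝ} (hR : 0 < R) {z : V} (hz : z ∈ sphere (0 : V) R) (t : I) :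
    radialPush R (z, t) = z := by
  rw [mem_sphere_zero_iff_norm] at hz
  simp [radialPush, hz, hR.ne']

open Classical in
/-- The map equal to `v` in the disc parametrized by `φ`, pushed radially at time `t`, and to `w`
outside of the disc. -/
def discHomotopy (φ : V → Y) (R : ℝ) (v : V → E) (w : Y → E) (p : Y × I) : E :=
  if p.1 ∈ φ '' ball 0 R then v (radialPush R (Function.invFun φ p.1, p.2)) else w p.1

omit [NormedSpace ℝ E] [FiniteDimensional ℝ E] in
theorem discHomotopy_continuousOn {K : Set Y} (hK : IsClosed K) {φ : V → Y} (hφ : IsEmbedding φ)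
    {R : ℝ} (hR : 0 < R) (h0 : φ 0 ∉ K) (hK' : IsClosed (K \ φ '' ball 0 R)) {v : V → E}
    (hv : Continuous v) {w : Y → E} (hw : ContinuousOn w (K \ φ '' ball 0 R))
    (hvw : ∀ z ∈ sphere (0 : V) R, φ z ∈ K → v z = w (φ z)) :
    ContinuousOn (discHomotopy φ R v w) (K ×ˢ univ) := by
  have hinv : ∀ z, Function.invFun φ (φ z) = z := Function.leftInverse_invFun hφ.injective
  have hψ : ContinuousOn (Function.invFun φ) (range φ) := by
    rw [continuousOn_iff_continuous_domRestrict, hφ.continuous_iff]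
    refine continuous_subtype_val.congr ?_
    rintro ⟨_, z, rfl⟩
    simp [hinv]
  have hD : IsClosed (φ '' closedBall 0 R) :=
    ((isCompact_closedBall (0 : V) R).image hφ.continuous).isClosed
  have hunion : K ×ˢ (univ : Set I) = (K ∩ φ '' closedBall 0 R) ×ˢ univ ∪
      (K \ φ '' ball 0 R) ×ˢ univ := by
    rw [← union_prod]
    congr 1
    have : φ '' ball (0 : V) R ⊆ φ '' closedBall 0 R := image_mono ball_subset_closedBall
    ext y
    constructor
    · intro hy
      by_cases h : y ∈ φ '' ball 0 R
      · exact Or.inl ⟨hy, this h⟩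
      · exact Or.inr ⟨hy, h⟩
    · rintro (h | h) <;> exact h.1
  rw [hunion]
  refine ContinuousOn.union_of_isClosed ?_ ?_ ((hK.inter hD).prod isClosed_univ)
    (hK'.prod isClosed_univ)
  · have hcont : ContinuousOn (fun p : Y × I => v (radialPush R (Function.invFun φ p.1, p.2)))
        ((K ∩ φ '' closedBall 0 R) ×ˢ univ) := by
      refine hv.comp_continuousOn ((continuousOn_radialPush R).comp
        (ContinuousOn.prodMk (hψ.comp continuousOn_fst ?_) continuousOn_snd) ?_)
      · rintro p ⟨⟨-, z, -, hz⟩, -⟩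
        exact ⟨z, hz⟩
      · rintro ⟨p, t⟩ ⟨⟨hpK, z, -, rfl⟩, -⟩
        simp only [mem_ofPred_eq, hinv]
        rintro rfl
        exact h0 hpK
    refine hcont.congr ?_
    rintro ⟨p, t⟩ ⟨⟨hpK, z, hz, rfl⟩, -⟩
    by_cases hzb : z ∈ ball (0 : V) R
    · simp only [discHomotopy, if_pos (mem_image_of_mem φ hzb)]
    · have hzs : z ∈ sphere (0 : V) R := by
        rw [mem_ball, not_lt] at hzb
        exact le_antisymm hz hzb
      have : φ z ∉ φ '' ball 0 R := by rwa [hφ.injective.mem_set_image]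
      simp only [discHomotopy, if_neg this, hinv, radialPush_of_mem_sphere hR hzs]
      exact (hvw z hzs hpK).symm
  · refine (hw.comp continuousOn_fst fun p hp => hp.1).congr fun p hp => ?_
    simp only [discHomotopy, if_neg hp.1.2, Function.comp]

/-- A nowhere vanishing map on `K` which extends after the interior of a disc has been removed
from `K` extends, provided `K` misses the centre of the disc. -/
theorem ExtendsNonvanishing.of_diff_image_ball
    (hVE : Module.finrank ℝ V < Module.finrank ℝ E) {K : Set Y} (hK : IsClosed K) {φ : V → Y}
    (hφ : IsEmbedding φ) {R : ℝ} (hR : 0 < R) (h0 : φ 0 ∉ K)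
    (hK' : IsClosed (K \ φ '' ball 0 R)) {f : Y → E} (hf : ContinuousOn f K)
    (hne : ∀ y ∈ K, f y ≠ 0) (hext : ExtendsNonvanishing (K \ φ '' ball 0 R) f) :
    ExtendsNonvanishing K f := by
  classical
  obtain ⟨G, hG, hGne, hGf⟩ := hext
  have hinv : ∀ z, Function.invFun φ (φ z) = z := Function.leftInverse_invFun hφ.injective
  have hsph : ∀ z ∈ sphere (0 : V) R, z ∉ ball (0 : V) R := fun z hz hz' =>
    (mem_ball.1 hz').ne hz
  have hGfs : ∀ z ∈ sphere (0 : V) R, φ z ∈ K → G (φ z) = f (φ z) := fun z hz hzK =>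
    hGf ⟨hzK, by rw [hφ.injective.mem_set_image]; exact hsph z hz⟩
  obtain ⟨v, hv, hvne, hvu⟩ : ExtendsNonvanishing (closedBall (0 : V) R ∩ φ ⁻¹' K ∪ sphere 0 R)
      (fun z => if z ∈ ball (0 : V) R then f (φ z) else G (φ z)) := by
    have hc1 : IsCompact (closedBall (0 : V) R ∩ φ ⁻¹' K) :=
      (isCompact_closedBall 0 R).inter_right (hK.preimage hφ.continuous)
    have hc2 := isCompact_sphere (0 : V) R
    refine extendsNonvanishing_of_finrank_lt hVE (hc1.union hc2) ?_ ?_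
    · refine ContinuousOn.union_of_isClosed ?_ ?_ hc1.isClosed hc2.isClosed
      · refine (hf.comp hφ.continuous.continuousOn fun z hz => hz.2).congr fun z hz => ?_
        by_cases hzb : z ∈ ball (0 : V) R
        · simp only [if_pos hzb, Function.comp]
        · simp only [if_neg hzb, Function.comp]
          exact hGfs z (le_antisymm hz.1 (not_lt.1 hzb)) hz.2
      · exact (hG.comp hφ.continuous).continuousOn.congr fun z hz => if_neg (hsph z hz)
    · rintro z hz
      by_cases hzb : z ∈ ball (0 : V) R
      · simp only [if_pos hzb]
        rcases hz with hz | hz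
        · exact hne _ hz.2
        · exact absurd hzb (hsph z hz)
      · simp only [if_neg hzb]
        exact hGne _
  have hvs : ∀ z ∈ sphere (0 : V) R, v z = G (φ z) := fun z hz =>
    (hvu (Or.inr hz)).trans (if_neg (hsph z hz))
  have hdne : ∀ {v' : V → E} {w' : Y → E}, (∀ z, v' z ≠ 0) → (∀ y ∈ K, w' y ≠ 0) →
      ∀ y ∈ K, ∀ t : I, discHomotopy φ R v' w' (y, t) ≠ 0 := by
    intro v' w' h1 h2 y hy t
    unfold discHomotopy
    split_ifs
    exacts [h1 _, h2 y hy]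
  have hcG := discHomotopy_continuousOn hK hφ hR h0 hK' (hG.comp hφ.continuous) hG.continuousOn
    fun _ _ _ => rfl
  have hcf := discHomotopy_continuousOn hK hφ hR h0 hK' hv (hf.mono sdiff_subset)
    fun z hz hzK => (hvs z hz).trans (hGfs z hz hzK)
  have e1 : ExtendsNonvanishing K fun y => discHomotopy φ R (G ∘ φ) G (y, 1) := by
    refine ExtendsNonvanishing.of_homotopy hK hcG (hdne (fun z => hGne _) fun y _ => hGne y)
      ⟨G, hG, hGne, fun y _ => ?_⟩
    by_cases hy : y ∈ φ '' ball 0 R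
    · obtain ⟨z, hz, rfl⟩ := hy
      simp only [discHomotopy, if_pos (mem_image_of_mem φ hz), radialPush_zero, hinv,
        Function.comp]
    · simp only [discHomotopy, if_neg hy]
  have e2 : ExtendsNonvanishing K fun y => discHomotopy φ R v f (y, 1) := by
    refine e1.congr fun y hyK => ?_
    by_cases hy : y ∈ φ '' ball 0 R
    · obtain ⟨z, hz, rfl⟩ := hy
      have hz0 : z ≠ 0 := by rintro rfl; exact h0 hyK
      simp only [discHomotopy, if_pos (mem_image_of_mem φ hz), hinv, Function.comp]
      exact (hvs _ (radialPush_one_mem hR.le hz0)).symm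
    · simp only [discHomotopy, if_neg hy]
      exact hGf ⟨hyK, hy⟩
  have e3 := ExtendsNonvanishing.of_homotopy hK
    (H := fun p : Y × I => discHomotopy φ R v f (p.1, σ p.2))
    (hcf.comp (by fun_prop) fun p hp => ⟨hp.1, trivial⟩)
    (fun y hy t => hdne hvne hne y hy _) (by simpa using e2)
  refine e3.congr fun y hyK => ?_
  by_cases hy : y ∈ φ '' ball 0 R
  · obtain ⟨z, hz, rfl⟩ := hy
    simp only [discHomotopy, if_pos (mem_image_of_mem φ hz), hinv, symm_one, radialPush_zero]
    rw [hvu (Or.inl ⟨ball_subset_closedBall hz, hyK⟩)]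
    exact if_pos hz
  · simp only [discHomotopy, if_neg hy]

end Extension

/-- The radial map about a point of a bounded open set `W` does not extend without zeros from a
set containing the frontier of `W`. -/
theorem not_extendsNonvanishing_sub {E : Type*} [NormedAddCommGroup E]
    [InnerProductSpace ℝ E] [FiniteDimensional ℝ E] [Nontrivial E] {K W : Set E}
    (hWb : Bornology.IsBounded W) (hWK : frontier W ⊆ K) {a : E} (ha : a ∈ W) :
    ¬ ExtendsNonvanishing K (· - a) := by
  classical
  rintro ⟨G, hG, hGne, hGK⟩
  have hpc : Continuous (W.piecewise G (· - a)) :=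
    continuous_piecewise (fun x hx => hGK (hWK hx)) hG.continuousOn (by fun_prop)
  obtain ⟨r, hr⟩ := hWb.subset_ball a
  obtain ⟨y, hy⟩ := exists_eq_zero_of_eq_self_of_le_norm (R := r)
    (hpc.comp (continuous_add_const a)) (fun y hy => by
      have : y + a ∉ W := fun h => by
        have := hr h
        simp at this
        linarith
      simp [this])
  by_cases hyW : y + a ∈ W
  · simp only [Function.comp, piecewise_eq_of_mem _ _ _ hyW] at hy
    exact hGne _ hy
  · simp only [Function.comp, piecewise_eq_of_notMem _ _ _ hyW, add_sub_cancel_right] at hy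
    rw [hy, zero_add] at hyW
    exact hyW ha

/-- The complement of any point of `S³` is parametrized by `ℝ³`. -/
theorem exists_isOpenEmbedding_range_eq_compl (x : S3) :
    ∃ i : R3 → S3, IsOpenEmbedding i ∧ range i = {x}ᶜ := by
  let e : S3 ≃ₜ sphere (0 : EuclideanSpace ℝ (Fin 4)) 1 := onePointEquivSphereOfFinrankEq (by simp)
  have : Fact (Module.finrank ℝ (EuclideanSpace ℝ (Fin 4)) = 3 + 1) := ⟨by simp⟩
  let s := stereographic' 3 (e x)
  have hs : IsOpenEmbedding s.symm := s.symm.isOpenEmbedding (by simp [s])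
  refine ⟨e.symm ∘ s.symm, e.symm.isOpenEmbedding.comp hs, ?_⟩
  have hr : range s.symm = {e x}ᶜ := by
    rw [← image_univ, ← stereographic'_target (e x), s.symm_image_target_eq_source,
      stereographic'_source]
  rw [range_comp, hr, image_compl_eq e.symm.bijective, image_singleton, e.symm_apply_apply]

instance : LocallyConnectedSpace S3 := by
  have : Fact (Module.finrank ℝ (EuclideanSpace ℝ (Fin 4)) = 3 + 1) := ⟨by simp⟩
  let e : S3 ≃ₜ sphere (0 : EuclideanSpace ℝ (Fin 4)) 1 := onePointEquivSphereOfFinrankEq (by simp)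
  have : LocallyConnectedSpace (sphere (0 : EuclideanSpace ℝ (Fin 4)) 1) :=
    ChartedSpace.locallyConnectedSpace (EuclideanSpace ℝ (Fin 3)) _
  exact e.isOpenEmbedding.locallyConnectedSpace

/-- A chart of a locally Euclidean set, as an embedding into the ambient space. -/
theorem LocallyEuclidean2.exists_isEmbedding {X : Type*} [TopologicalSpace X] {S : Set X}
    (hS : LocallyEuclidean2 S) (hc : IsClosed S) {p : X} (hp : p ∈ S) :
    ∃ φ : EuclideanSpace ℝ (Fin 2) → X, IsEmbedding φ ∧ range φ ⊆ S ∧ p ∈ range φ ∧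
      ∀ O, IsOpen O → IsClosed (S \ φ '' O) := by
  obtain ⟨V, hV, hpV, ⟨e⟩⟩ := hS ⟨p, hp⟩
  have hval : IsOpenEmbedding (fun z => (e.symm z : S)) :=
    hV.isOpenEmbedding_subtypeVal.comp e.symm.isOpenEmbedding
  refine ⟨fun z => ((e.symm z : S) : X), IsEmbedding.subtypeVal.comp hval.isEmbedding, ?_,
    ⟨e ⟨_, hpV⟩, by simp⟩, fun O hO => ?_⟩
  · rintro _ ⟨z, rfl⟩
    exact Subtype.coe_prop _
  · have h := hc.isClosedEmbedding_subtypeVal.isClosedMap _ (hval.isOpenMap O hO).isClosed_compl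
    convert h using 1
    rw [image_compl_eq_range_sdiff_image Subtype.val_injective, Subtype.range_coe, image_image]

section Separation

variable {X : Type*} [TopologicalSpace X] [T2Space X] [CompactSpace X] {x : X} {i : R3 → X}

/-- The radial map about `a` extends from `K` without zeros if `K` does not separate `i a` from the
point at infinity. -/
theorem ExtendsNonvanishing.sub_of_isPreconnected (hi : IsOpenEmbedding i) (hr : range i = {x}ᶜ)
    {K C : Set X} (hK : IsClosed K) (hC : IsPreconnected C) (hCK : C ⊆ Kᶜ) (hx : x ∈ C) {a : R3}
    (ha : i a ∈ C) : ExtendsNonvanishing (i ⁻¹' K) (· - a) := by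
  have hxK : x ∉ K := hCK hx
  have hKc : IsCompact (i ⁻¹' K) := by
    refine (hi.isInducing.isCompact_preimage_iff ?_).2 hK.isCompact
    rw [hr]
    exact subset_compl_singleton_iff.2 hxK
  set P : R3 → Prop := fun b => ExtendsNonvanishing (i ⁻¹' K) (· - b)
  have hloc : ∀ b ∉ i ⁻¹' K, ∃ ρ > 0, ∀ c ∈ ball b ρ, P c ↔ P b := by
    intro b hb
    obtain ⟨ρ, hρ, hsub⟩ := Metric.isOpen_iff.1 hKc.isClosed.isOpen_compl b hb
    have hd : Disjoint (ball b ρ) (i ⁻¹' K) := subset_compl_iff_disjoint_right.1 hsub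
    have hbb : b ∈ ball b ρ := mem_ball_self hρ
    exact ⟨ρ, hρ, fun c hc => ⟨fun h => h.sub_of_mem_ball hKc.isClosed hd hc hbb,
      fun h => h.sub_of_mem_ball hKc.isClosed hd hbb hc⟩⟩
  have hopen : ∀ Q : Prop → Prop, IsOpen {b | b ∉ i ⁻¹' K ∧ Q (P b)} := by
    intro Q
    rw [Metric.isOpen_iff]
    rintro b ⟨hb, hQ⟩
    obtain ⟨ρ, hρ, h⟩ := hloc b hb
    obtain ⟨ρ', hρ', h'⟩ := Metric.isOpen_iff.1 hKc.isClosed.isOpen_compl b hb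
    refine ⟨min ρ ρ', lt_min hρ hρ', fun c hc => ⟨h' (ball_subset_ball (min_le_right _ _) hc), ?_⟩⟩
    rwa [propext (h c (ball_subset_ball (min_le_left _ _) hc))]
  obtain ⟨r, hr0, hKr⟩ := hKc.isBounded.subset_ball_lt 0 0
  have hfar : ∀ b ∉ closedBall (0 : R3) r, P b := by
    intro b hb
    simp only [mem_closedBall, dist_zero_right, not_le] at hb
    refine ExtendsNonvanishing.sub_of_norm_le hKc.isClosed (fun y hy => ?_)
      (norm_pos_iff.1 (hr0.trans hb))
    have := hKr hy
    rw [mem_ball_zero_iff] at this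
    exact this.trans hb
  set N : Set X := i '' {b | b ∉ i ⁻¹' K ∧ P b} ∪ (i '' closedBall 0 r)ᶜ
  set M : Set X := i '' {b | b ∉ i ⁻¹' K ∧ ¬ P b}
  have hN : IsOpen N := (hi.isOpenMap _ (hopen id)).union
    ((isCompact_closedBall _ _).image hi.continuous).isClosed.isOpen_compl
  have hM : IsOpen M := hi.isOpenMap _ (hopen Not)
  have hNM : Disjoint N M := by
    rw [Set.disjoint_left]
    rintro y hyN ⟨b, hb, rfl⟩
    rcases hyN with ⟨c, hc, hcb⟩ | h
    · rw [hi.injective hcb] at hc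
      exact hb.2 hc.2
    · exact hb.2 (hfar b fun hb' => h ⟨b, hb', rfl⟩)
  have hcov : C ⊆ N ∪ M := by
    intro y hy
    by_cases hyx : y ∈ range i
    · obtain ⟨b, rfl⟩ := hyx
      by_cases hb : P b
      · exact Or.inl (Or.inl ⟨b, ⟨hCK hy, hb⟩, rfl⟩)
      · exact Or.inr ⟨b, ⟨hCK hy, hb⟩, rfl⟩
    · exact Or.inl (Or.inr fun h => hyx (image_subset_range _ _ h))
  have hxN : x ∈ N := by
    refine Or.inr fun h => ?_
    have := image_subset_range _ _ h
    rw [hr] at this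
    exact this rfl
  have haN := hC.subset_left_of_subset_union hN hM hNM hcov ⟨x, hx, hxN⟩ ha
  by_contra hPa
  exact Set.disjoint_left.1 hNM haN ⟨a, ⟨hCK ha, hPa⟩, rfl⟩

/-- A closed part of a connected surface which bounds a domain `W`, and is adherent to a domain `U`
not adherent to `W`, is the whole surface. -/
theorem eq_of_subset_closure_of_isPreconnected [LocallyConnectedSpace X] (hi : IsOpenEmbedding i)
    (hr : range i = {x}ᶜ) {S F U W : Set X} (hS : IsClosed S) (hSc : IsPreconnected S)
    (hle : LocallyEuclidean2 S) (hxS : x ∉ S) (hF : IsClosed F) (hFS : F ⊆ S) (hFne : F.Nonempty)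
    (hU : IsPreconnected U) (hUF : Disjoint U F) (hFU : F ⊆ closure U) (hxU : x ∈ U)
    (hW : IsPreconnected W) (hWF : frontier W = F) (hWd : Disjoint W F) (hWne : W.Nonempty)
    (hxW : x ∉ closure W) : F = S := by
  by_contra hne
  obtain ⟨q, hq⟩ := hWne
  have hFW : F ⊆ closure W := hWF ▸ frontier_subset_closure
  have hSi : S ⊆ range i := by rw [hr]; exact subset_compl_singleton_iff.2 hxS
  obtain ⟨a, rfl⟩ : q ∈ range i := by
    rw [hr]; rintro rfl; exact hxW (subset_closure hq)
  obtain ⟨p, -, hpF, hpS⟩ := isPreconnected_closed_iff.1 hSc F (closure (S \ F)) hF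
    isClosed_closure (fun y hy => (em (y ∈ F)).imp id fun h => subset_closure ⟨hy, h⟩)
    (hFne.mono fun y hy => ⟨hFS hy, hy⟩)
    ((nonempty_of_ssubset (hFS.ssubset_of_ne hne)).mono fun y hy => ⟨hy.1, subset_closure hy⟩)
  obtain ⟨φ, hφ, hφS, hpφ, hφc⟩ := hle.exists_isEmbedding hS (hFS hpF)
  obtain ⟨_, ⟨hz0S, hz0⟩⟩ := mem_closure_iff.1 hpS _ (hφc univ isOpen_univ).isOpen_compl
    (by simpa using fun _ => hpφ)
  obtain ⟨z₀, rfl⟩ : _ ∈ range φ := by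
    by_contra h
    exact hz0S ⟨hz0.1, by rwa [image_univ]⟩
  obtain ⟨z₁, rfl⟩ := hpφ
  set τ := Homeomorph.addRight z₀
  set R := ‖z₁ - z₀‖ + 1
  have hR : 0 < R := by positivity
  obtain ⟨χ, hχ⟩ : ∃ χ : EuclideanSpace ℝ (Fin 2) → R3, ∀ z, i (χ z) = φ (z + z₀) :=
    ⟨_, fun z => (hSi (hφS ⟨z + z₀, rfl⟩)).choose_spec⟩
  have hiχ : i ∘ χ = φ ∘ τ := funext hχ
  have hχe : IsEmbedding χ := by
    have h : IsEmbedding (i ∘ χ) := hiχ ▸ hφ.comp τ.isEmbedding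
    exact IsEmbedding.of_comp (hi.isInducing.continuous_iff.2 h.continuous) hi.continuous h
  set K := F \ φ '' (τ '' ball 0 R)
  have hK : IsClosed K := by
    have : K = F ∩ (S \ φ '' (τ '' ball 0 R)) := by
      ext y; exact ⟨fun h => ⟨h.1, hFS h.1, h.2⟩, fun h => ⟨h.1, h.2.2⟩⟩
    rw [this]
    exact hF.inter (hφc _ (τ.isOpenMap _ isOpen_ball))
  have hpK : φ z₁ ∉ K := fun h => h.2 ⟨z₁, ⟨z₁ - z₀, by simp [R], by simp [τ]⟩, rfl⟩
  set B := connectedComponentIn Kᶜ (φ z₁)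
  have hB : IsOpen B := hK.isOpen_compl.connectedComponentIn
  have hpB : φ z₁ ∈ B := mem_connectedComponentIn hpK
  have hBc : IsPreconnected B := isPreconnected_connectedComponentIn
  have hUB : (U ∩ B).Nonempty := by
    rw [inter_comm]; exact mem_closure_iff.1 (hFU hpF) B hB hpB
  have hBW : (B ∩ W).Nonempty := mem_closure_iff.1 (hFW hpF) B hB hpB
  have hC : IsPreconnected (U ∪ B ∪ W) :=
    (hU.union' hUB hBc).union' (hBW.mono (inter_subset_inter_left _ subset_union_right)) hW
  have hCK : U ∪ B ∪ W ⊆ Kᶜ := by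
    rintro y ((hy | hy) | hy) hyK
    · exact Set.disjoint_left.1 hUF hy hyK.1
    · exact connectedComponentIn_subset _ _ hy hyK
    · exact Set.disjoint_left.1 hWd hy hyK.1
  have hextK := ExtendsNonvanishing.sub_of_isPreconnected hi hr hK hC hCK (Or.inl (Or.inl hxU))
    (Or.inr hq)
  have hKpre : i ⁻¹' F \ χ '' ball 0 R = i ⁻¹' K := by
    have himg : i '' (χ '' ball 0 R) = φ '' (τ '' ball 0 R) := by
      rw [← image_comp, hiχ, image_comp]
    change _ = i ⁻¹' (F \ φ '' (τ '' ball 0 R))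
    rw [← himg, preimage_sdiff, hi.injective.preimage_image]
  have hWb : Bornology.IsBounded (i ⁻¹' W) := by
    have : IsCompact (i ⁻¹' closure W) := by
      refine (hi.isInducing.isCompact_preimage_iff ?_).2 isClosed_closure.isCompact
      rw [hr]
      exact subset_compl_singleton_iff.2 hxW
    exact this.isBounded.subset (preimage_mono subset_closure)
  refine not_extendsNonvanishing_sub hWb (K := i ⁻¹' F) ?_ hq ?_
  · rw [← hWF, hi.isOpenMap.preimage_frontier_eq_frontier_preimage hi.continuous]
  · refine ExtendsNonvanishing.of_diff_image_ball (by simp) (hF.preimage hi.continuous) hχe hR ?_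
      ?_ (by fun_prop) ?_ (hKpre ▸ hextK)
    · rw [mem_preimage, hχ, zero_add]
      exact hz0.2
    · rw [hKpre]; exact hK.preimage hi.continuous
    · intro y hy h
      rw [sub_eq_zero.1 h] at hy
      exact Set.disjoint_left.1 hWd hq hy

end Separation

/-- For a closed connected surface `S` in `S³` (a nonempty compact connected set that is
locally Euclidean of dimension 2), the topological frontier of every connected component
of `S³ ∖ S` equals `S`. -/
theorem frontier_of_complementary_domain_eq_surface (S : Set S3) (hne : S.Nonempty)
    (hc : IsCompact S) (hconn : IsConnected S) (hle : LocallyEuclidean2 S) :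
    ∀ x : S3, x ∉ S → frontier (connectedComponentIn Sᶜ x) = S := by
  intro x hx
  have hSc : IsClosed S := hc.isClosed
  set U := connectedComponentIn Sᶜ x
  have hU : IsOpen U := hSc.isOpen_compl.connectedComponentIn
  have hUc : IsPreconnected U := isPreconnected_connectedComponentIn
  have hxU : x ∈ U := mem_connectedComponentIn hx
  have hUS : U ⊆ Sᶜ := connectedComponentIn_subset _ _
  have hfU : frontier U ⊆ S := by
    intro p hp
    by_contra hpS
    have hV : IsOpen (connectedComponentIn Sᶜ p) := hSc.isOpen_compl.connectedComponentIn
    obtain ⟨y, hyp, hyU⟩ := mem_closure_iff.1 hp.1 _ hV (mem_connectedComponentIn hpS)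
    have : connectedComponentIn Sᶜ p = U :=
      (connectedComponentIn_eq hyp).trans (connectedComponentIn_eq hyU).symm
    rw [hU.frontier_eq] at hp
    exact hp.2 (this ▸ mem_connectedComponentIn hpS)
  refine hfU.antisymm fun q hqS => ?_
  by_contra hqF
  have hF : IsOpen (frontier U)ᶜ := isClosed_frontier.isOpen_compl
  set W := connectedComponentIn (frontier U)ᶜ q
  have hW : IsOpen W := hF.connectedComponentIn
  have hWc : IsPreconnected W := isPreconnected_connectedComponentIn
  have hqW : q ∈ W := mem_connectedComponentIn hqF
  have hWF : W ⊆ (frontier U)ᶜ := connectedComponentIn_subset _ _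
  have hWU : Disjoint U W := by
    by_contra h
    obtain ⟨y, hyU, hyW⟩ := Set.not_disjoint_iff.1 h
    refine hUS (hWc.subset_left_of_subset_union hU isClosed_closure.isOpen_compl
      (disjoint_compl_right_iff_subset.2 subset_closure) (fun z hz => ?_) ⟨y, hyW, hyU⟩ hqW) hqS
    by_contra hzU
    rw [mem_union, not_or, notMem_compl_iff] at hzU
    exact hWF hz (hU.frontier_eq ▸ ⟨hzU.2, hzU.1⟩)
  have hfW : frontier W ⊆ frontier U := by
    intro p hp
    by_contra hpF
    obtain ⟨y, hyp, hyW⟩ := mem_closure_iff.1 hp.1 _ hF.connectedComponentIn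
      (mem_connectedComponentIn (x := p) hpF)
    have : connectedComponentIn (frontier U)ᶜ p = W :=
      (connectedComponentIn_eq hyp).trans (connectedComponentIn_eq hyW).symm
    rw [hW.frontier_eq] at hp
    exact hp.2 (this ▸ mem_connectedComponentIn hpF)
  have hxW : x ∉ closure W := fun h => by
    obtain ⟨y, hyU, hyW⟩ := mem_closure_iff.1 h U hU hxU
    exact Set.disjoint_left.1 hWU hyU hyW
  have hfWne : (frontier W).Nonempty := by
    by_contra h
    rw [not_nonempty_iff_eq_empty, ← isClopen_iff_frontier_eq_empty] at h
    rw [h.eq_univ ⟨q, hqW⟩] at hxW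
    simp at hxW
  obtain ⟨i, hi, hr⟩ := exists_isOpenEmbedding_range_eq_compl x
  have hUf : Disjoint U (frontier W) :=
    Set.disjoint_left.2 fun y hyU hyW => hUS hyU (hfU (hfW hyW))
  have hfS := eq_of_subset_closure_of_isPreconnected hi hr hSc hconn.isPreconnected hle hx
    isClosed_frontier (hfW.trans hfU) hfWne hUc hUf (hfW.trans frontier_subset_closure) hxU hWc rfl
    (disjoint_frontier_iff_isOpen.2 hW).symm ⟨q, hqW⟩ hxW
  exact hqF (hfW (hfS ▸ hqS))
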